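/- arXiv:2406.07509 — 5 statements merged into one kernel-verified Lean document; each statement's English description precedes it below -/
import Mathlib

section
/- Let (a_n)_{n≥0} and (b_n)_{n≥0} be sequences of positive real numbers such that: (i) a_n → ∞, a_{n+1} > a_n + b_n and a_n ≥ b_n for every n; (ii) Σ_{n=0}^∞ b_n/a_n ≤ 1/16. Set I_n := [a_n, a_n + b_n] and let J_n be subsets whose closure is contained in the interior of I_n. Then there exists a smooth concave function φ : [0,∞) → ℝ with φ(r) = r in a neighborhood of 0 such that: φ'(r) ≥ 7/8 and φ(r) ≥ (7/8)r for all r ≥ 0; |φ''(r)| ≤ 2/a_n for all r ∈ I_n and every n; |φ''(r)| ≥ 1/a_n for all r ∈ J_n and every n; φ''(r) = 0 for all r ∈ (0,∞) \ ∪_{n=0}^∞ I_n; (φ(r)φ''(r) − (φ'(r))² + 1)/φ(r)² < 0 for all r ∈ J_n and every n; and −φ''(r)/φ(r) ≤ 16/r² for all r ∈ (0,∞). -/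
open Set Filter MeasureTheory

theorem deriv_intervalIntegral_of_continuous {f : ℝ → ℝ} (hf : Continuous f) :
    deriv (fun x => ∫ t in (0 : ℝ)..x, f t) = f :=
  funext fun x => hf.deriv_integral f 0 x

theorem contDiff_infty_intervalIntegral {f : ℝ → ℝ} (hf : ContDiff ℝ (⊤ : ℕ∞) f) :
    ContDiff ℝ (⊤ : ℕ∞) (fun x => ∫ t in (0 : ℝ)..x, f t) := by
  rw [contDiff_infty_iff_deriv, deriv_intervalIntegral_of_continuous hf.continuous]
  exact ⟨fun x => (hf.continuous.integral_hasStrictDerivAt 0 x).hasDerivAt.differentiableAt, hf⟩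

/-- A smooth bump function equal to one on `J` and supported in an interval around `J`. -/
theorem exists_contDiff_bump {J : Set ℝ} {c d : ℝ} (hJ : closure J ⊆ interior (Icc c d)) :
    ∃ χ : ℝ → ℝ, ContDiff ℝ (⊤ : ℕ∞) χ ∧ (∀ x, χ x ∈ Icc (0 : ℝ) 1) ∧
      (∀ x ∈ J, χ x = 1) ∧ ∀ x ∉ Ioo c d, χ x = 0 := by
  rw [interior_Icc] at hJ
  obtain ⟨χ, h₀, h₁, h⟩ := exists_contMDiffMap_zero_one_of_isClosed (n := (⊤ : ℕ∞))
    (modelWithCornersSelf ℝ ℝ) (isOpen_Ioo (a := c) (b := d)).isClosed_compl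
    (isClosed_closure (s := J)) (disjoint_compl_left_iff_subset.2 hJ)
  exact ⟨χ, χ.contMDiff.contDiff, h, fun x hx => h₁ (subset_closure hx), fun x hx => h₀ hx⟩

theorem intervalIntegral_le_mul_of_support_subset {g : ℝ → ℝ} {c d M r : ℝ} (hg : Continuous g)
    (hM : ∀ x, g x ≤ M) (hM₀ : 0 ≤ M) (hcd : c ≤ d) (hsupp : ∀ x ∉ Icc c d, g x = 0)
    (hr : 0 ≤ r) : ∫ t in (0 : ℝ)..r, g t ≤ M * (d - c) := by
  have hint : Integrable ((Icc c d).indicator fun _ => M) :=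
    (integrable_indicator_iff measurableSet_Icc).2 (integrableOn_const (by simp))
  calc ∫ t in (0 : ℝ)..r, g t
      ≤ ∫ t in (0 : ℝ)..r, (Icc c d).indicator (fun _ => M) t := by
        refine intervalIntegral.integral_mono_on hr (hg.intervalIntegrable _ _)
          hint.intervalIntegrable fun x _ => ?_
        by_cases hx : x ∈ Icc c d
        · simpa [hx] using hM x
        · simp [hx, hsupp x hx]
    _ ≤ ∫ t, (Icc c d).indicator (fun _ => M) t := by
        rw [intervalIntegral.integral_of_le hr]
        exact setIntegral_le_integral hint
          (Eventually.of_forall fun x => indicator_nonneg (fun _ _ => hM₀) x)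
    _ = M * (d - c) := by
        rw [integral_indicator measurableSet_Icc, setIntegral_const, Real.volume_real_Icc_of_le hcd,
          smul_eq_mul, mul_comm]

/-- A smooth concave function with prescribed second derivative `-f`, where `f` has small mass. -/
theorem exists_contDiff_deriv_deriv_eq_neg {f : ℝ → ℝ} {ε δ : ℝ} (hf : ContDiff ℝ (⊤ : ℕ∞) f)
    (hf₀ : ∀ x, 0 ≤ f x) (hε : ∀ x ≤ ε, f x = 0)
    (hδ : ∀ r, 0 ≤ r → ∫ t in (0 : ℝ)..r, f t ≤ δ) :
    ∃ φ : ℝ → ℝ, ContDiff ℝ (⊤ : ℕ∞) φ ∧ (∀ r ∈ Icc 0 ε, φ r = r) ∧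
      (∀ r, deriv (deriv φ) r = -f r) ∧
      (∀ r, 0 ≤ r → deriv φ r ∈ Icc (1 - δ) 1) ∧ ∀ r, 0 ≤ r → (1 - δ) * r ≤ φ r := by
  set F : ℝ → ℝ := fun x => 1 - ∫ t in (0 : ℝ)..x, f t with hF
  have hFs : ContDiff ℝ (⊤ : ℕ∞) F := contDiff_const.sub (contDiff_infty_intervalIntegral hf)
  have hd := deriv_intervalIntegral_of_continuous hFs.continuous
  have hFmem : ∀ r, 0 ≤ r → F r ∈ Icc (1 - δ) 1 := fun r hr =>
    ⟨sub_le_sub_left (hδ r hr) 1,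
      sub_le_self 1 (intervalIntegral.integral_nonneg hr fun x _ => hf₀ x)⟩
  refine ⟨fun x => ∫ t in (0 : ℝ)..x, F t, contDiff_infty_intervalIntegral hFs, ?_, ?_, ?_, ?_⟩
  · intro r hr
    have hF₁ : ∀ x ∈ Icc 0 ε, F x = 1 := fun x hx => by
      have : ∫ t in (0 : ℝ)..x, f t = ∫ t in (0 : ℝ)..x, 0 :=
        intervalIntegral.integral_congr fun t ht =>
          hε t ((uIcc_of_le hx.1 ▸ ht : t ∈ Icc 0 x).2.trans hx.2)
      simp [hF, this]
    have : ∫ t in (0 : ℝ)..r, F t = ∫ t in (0 : ℝ)..r, 1 :=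
      intervalIntegral.integral_congr fun t ht =>
        have ht' : t ∈ Icc 0 r := uIcc_of_le hr.1 ▸ ht
        hF₁ t ⟨ht'.1, ht'.2.trans hr.2⟩
    simp [this]
  · intro r
    rw [hd, hF, deriv_const_sub, deriv_intervalIntegral_of_continuous hf.continuous]
  · rw [hd]
    exact hFmem
  · intro r hr
    calc (1 - δ) * r = ∫ _ in (0 : ℝ)..r, (1 - δ) := by
          rw [intervalIntegral.integral_const, smul_eq_mul, sub_zero, mul_comm]
      _ ≤ ∫ t in (0 : ℝ)..r, F t :=
        intervalIntegral.integral_mono_on hr (by simp) (hFs.continuous.intervalIntegrable _ _)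
          fun x hx => (hFmem x hx.1).1

/-- Given sequences `(aₙ)`, `(bₙ)` of positive reals with `aₙ → ∞`,
`aₙ₊₁ > aₙ + bₙ`, `aₙ ≥ bₙ`, and `∑ bₙ/aₙ ≤ 1/16`, with intervals `Iₙ = [aₙ, aₙ + bₙ]`
and sets `Jₙ` compactly contained in the interior of `Iₙ`, there exists a smooth concave
function `φ` with `φ(r) = r` near `0`, `φ' ≥ 7/8`, `φ(r) ≥ (7/8)r`, `|φ''| ≤ 2/aₙ` on `Iₙ`,
`|φ''| ≥ 1/aₙ` on `Jₙ`, `φ'' = 0` off `⋃ Iₙ`, `(φφ'' - (φ')² + 1)/φ² < 0` on `Jₙ`, and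
`-φ''/φ ≤ 16/r²` on `(0, ∞)`. -/
theorem stmt_0 (a b : ℕ → ℝ) (J : ℕ → Set ℝ)
    (ha : ∀ n, 0 < a n) (hb : ∀ n, 0 < b n)
    (hdiv : Tendsto a atTop atTop)
    (hsep : ∀ n, a n + b n < a (n + 1))
    (hab : ∀ n, b n ≤ a n)
    (hsummable : Summable (fun n => b n / a n))
    (hsum : (∑' n, b n / a n) ≤ 1 / 16)
    (hJ : ∀ n, closure (J n) ⊆ interior (Icc (a n) (a n + b n))) :
    ∃ φ : ℝ → ℝ, ContDiff ℝ (⊤ : ℕ∞) φ ∧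
      (∃ ε > (0:ℝ), ∀ r ∈ Icc (0:ℝ) ε, φ r = r) ∧
      (∀ r ∈ Ici (0:ℝ), deriv (deriv φ) r ≤ 0) ∧
      (∀ r ∈ Ici (0:ℝ), 7 / 8 ≤ deriv φ r ∧ 7 / 8 * r ≤ φ r) ∧
      (∀ n, ∀ r ∈ Icc (a n) (a n + b n), |deriv (deriv φ) r| ≤ 2 / a n) ∧
      (∀ n, ∀ r ∈ J n, 1 / a n ≤ |deriv (deriv φ) r|) ∧
      (∀ r ∈ Ioi (0:ℝ), r ∉ (⋃ n, Icc (a n) (a n + b n)) → deriv (deriv φ) r = 0) ∧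
      (∀ n, ∀ r ∈ J n,
        (φ r * deriv (deriv φ) r - (deriv φ r) ^ 2 + 1) / (φ r) ^ 2 < 0) ∧
      (∀ r ∈ Ioi (0:ℝ), -(deriv (deriv φ) r) / φ r ≤ 16 / r ^ 2) := by
  have hmono : StrictMono a := strictMono_nat_of_lt_succ fun n => by linarith [hb n, hsep n]
  choose χ hχs hχ hχJ hχ₀ using fun n => exists_contDiff_bump (hJ n)
  set g : ℕ → ℝ → ℝ := fun n x => χ n x / a n with hg
  have hgs : ∀ n, ContDiff ℝ (⊤ : ℕ∞) (g n) := fun n => (hχs n).div_const _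
  have hg₀ : ∀ n x, 0 ≤ g n x := fun n x => div_nonneg (hχ n x).1 (ha n).le
  have hg₁ : ∀ n x, g n x ≤ 1 / a n := fun n x => div_le_div_of_nonneg_right (hχ n x).2 (ha n).le
  have hgsupp : ∀ n, ∀ x ∉ Ioo (a n) (a n + b n), g n x = 0 := fun n x hx => by
    simp [hg, hχ₀ n x hx]
  have hfin : ∀ R, ∃ N, ∀ n, N ≤ n → ∀ x ≤ R, g n x = 0 := fun R => by
    obtain ⟨N, hN⟩ := eventually_atTop.1 (hdiv.eventually_ge_atTop R)
    exact ⟨N, fun n hn x hx => hgsupp n x fun h => (hx.trans (hN n hn)).not_gt h.1⟩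
  have hloc : LocallyFinite fun n => Function.support (g n) := fun x => by
    obtain ⟨N, hN⟩ := hfin (x + 1)
    refine ⟨Iio (x + 1), Iio_mem_nhds (lt_add_one x), (finite_Iio N).subset ?_⟩
    rintro n ⟨y, hy, hyR⟩
    by_contra hn
    exact hy (hN n (not_lt.1 hn) y (mem_Iio.1 hyR).le)
  set f : ℝ → ℝ := fun x => ∑ᶠ n, g n x with hf
  have hfs : ContDiff ℝ (⊤ : ℕ∞) f :=
    (contMDiff_finsum (fun n => (hgs n).contMDiff) hloc).contDiff
  have hf₀ : ∀ x, 0 ≤ f x := fun x => finsum_nonneg fun n => hg₀ n x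
  have hfoff : ∀ x, (∀ n, x ∉ Ioo (a n) (a n + b n)) → f x = 0 := fun x hx =>
    finsum_eq_zero_of_forall_eq_zero fun n => hgsupp n x (hx n)
  have hfon : ∀ n, ∀ x ∈ Icc (a n) (a n + b n), f x = g n x := fun n x hx => by
    refine finsum_eq_single _ n fun m hm => hgsupp m x fun h => ?_
    rcases lt_or_gt_of_ne hm with hmn | hmn
    · linarith [hmono.monotone (Nat.succ_le_of_lt hmn), hsep m, hx.1, h.2]
    · linarith [hmono.monotone (Nat.succ_le_of_lt hmn), hsep n, hx.2, h.1]
  have hfint : ∀ r, 0 ≤ r → ∫ t in (0 : ℝ)..r, f t ≤ 1 / 16 := fun r hr => by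
    obtain ⟨N, hN⟩ := hfin r
    have hsumeq : ∀ t ≤ r, f t = ∑ n ∈ Finset.range N, g n t := fun t ht =>
      finsum_eq_sum_of_support_subset _ fun n hn => by
        by_contra h
        exact hn (hN n (by simpa using h) t ht)
    calc ∫ t in (0 : ℝ)..r, f t = ∫ t in (0 : ℝ)..r, ∑ n ∈ Finset.range N, g n t :=
          intervalIntegral.integral_congr fun t ht =>
            hsumeq t (uIcc_of_le hr ▸ ht : t ∈ Icc 0 r).2
      _ = ∑ n ∈ Finset.range N, ∫ t in (0 : ℝ)..r, g n t :=
          intervalIntegral.integral_finsetSum fun n _ =>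
            (hgs n).continuous.intervalIntegrable _ _
      _ ≤ ∑ n ∈ Finset.range N, b n / a n := by
          refine Finset.sum_le_sum fun n _ => ?_
          refine (intervalIntegral_le_mul_of_support_subset (hgs n).continuous (hg₁ n)
            (one_div_nonneg.2 (ha n).le) (by linarith [hb n])
            (fun x hx => hgsupp n x fun h => hx (Ioo_subset_Icc_self h)) hr).trans_eq ?_
          ring
      _ ≤ ∑' n, b n / a n :=
          hsummable.sum_le_tsum _ fun n _ => div_nonneg (hb n).le (ha n).le
      _ ≤ 1 / 16 := hsum
  have hfε : ∀ x ≤ a 0, f x = 0 := fun x hx =>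
    hfoff x fun n h => (hx.trans (hmono.monotone n.zero_le)).not_gt h.1
  obtain ⟨φ, hφs, hφε, hφ₂, hφ₁, hφ₀⟩ := exists_contDiff_deriv_deriv_eq_neg hfs hf₀ hfε hfint
  have hφge : ∀ r, 0 ≤ r → 7 / 8 * r ≤ φ r := fun r hr => by linarith [hφ₀ r hr]
  have hJI : ∀ n, J n ⊆ Icc (a n) (a n + b n) := fun n =>
    subset_closure.trans ((hJ n).trans interior_subset)
  have hfJ : ∀ n, ∀ r ∈ J n, f r = 1 / a n := fun n r hr => by
    rw [hfon n r (hJI n hr), hg]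
    simp [hχJ n r hr]
  refine ⟨φ, hφs, ⟨a 0, ha 0, hφε⟩, fun r _ => ?_, fun r hr => ⟨?_, hφge r hr⟩, fun n r hr => ?_,
    fun n r hr => ?_, fun r _ hr => ?_, fun n r hr => ?_, fun r hr => ?_⟩
  · rw [hφ₂]
    exact neg_nonpos.2 (hf₀ r)
  · linarith [(hφ₁ r hr).1]
  · rw [hφ₂, abs_neg, abs_of_nonneg (hf₀ r), hfon n r hr]
    exact (hg₁ n r).trans (div_le_div_of_nonneg_right one_le_two (ha n).le)
  · rw [hφ₂, abs_neg, abs_of_nonneg (hf₀ r), hfJ n r hr]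
  · rw [hφ₂, hfoff r fun n h => hr (mem_iUnion_of_mem n (Ioo_subset_Icc_self h)), neg_zero]
  · have har : a n ≤ r := (hJI n hr).1
    have hr₀ : 0 < r := (ha n).trans_le har
    have hφr := hφge r hr₀.le
    refine div_neg_of_neg_of_pos ?_ (pow_pos (by linarith) 2)
    rw [hφ₂, hfJ n r hr]
    have h₁ : 7 / 8 ≤ φ r * (1 / a n) := by
      rw [mul_one_div, le_div_iff₀ (ha n)]
      linarith
    nlinarith [(hφ₁ r hr₀.le).1]
  · have hr₀ : 0 < r := hr
    have hφr := hφge r hr₀.le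
    rw [hφ₂, neg_neg]
    by_cases h : ∃ n, r ∈ Icc (a n) (a n + b n)
    · obtain ⟨n, hn⟩ := h
      have hfr : f r ≤ 2 / r := by
        rw [hfon n r hn]
        refine (hg₁ n r).trans ?_
        rw [div_le_div_iff₀ (ha n) hr₀]
        linarith [hn.2, hab n]
      calc f r / φ r ≤ 2 / r / (7 / 8 * r) :=
            div_le_div₀ (by positivity) hfr (by positivity) hφr
        _ = 16 / 7 / r ^ 2 := by field_simp; norm_num
        _ ≤ 16 / r ^ 2 := by gcongr; norm_num
    · rw [hfoff r fun n hn => h ⟨n, Ioo_subset_Icc_self hn⟩, zero_div]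
      positivity
end

section
/- Let (a_n)_{n≥0} and (b_n)_{n≥0} be sequences of positive real numbers with a_n ≥ b_n for every n, and set I_n := [a_n, a_n + b_n]. Let φ : (0,∞) → ℝ be a C² function such that φ(r) ≥ (7/8) r for all r > 0, φ''(r) ≤ 0 for all r > 0, φ''(r) = 0 for all r ∈ (0,∞) \ ∪_{n=0}^∞ I_n, and −φ''(r) ≤ 2/a_n for all r ∈ I_n and every n. Then 0 ≤ −φ''(r)/φ(r) ≤ 16/r² for all r ∈ (0,∞). -/
open Set Filter

/-- Let `(aₙ)`, `(bₙ)` be positive with `aₙ ≥ bₙ`, `Iₙ = [aₙ, aₙ + bₙ]`.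
If `φ` is `C²` on `(0, ∞)` with `φ(r) ≥ (7/8)r`, `φ'' ≤ 0`, `φ'' = 0` off `⋃ Iₙ`, and
`-φ'' ≤ 2/aₙ` on `Iₙ`, then `0 ≤ -φ''(r)/φ(r) ≤ 16/r²` for all `r > 0`. -/
theorem stmt_2 (a b : ℕ → ℝ) (φ : ℝ → ℝ)
    (ha : ∀ n, 0 < a n) (hb : ∀ n, 0 < b n) (hab : ∀ n, b n ≤ a n)
    (hφ : ContDiffOn ℝ 2 φ (Ioi 0))
    (hlow : ∀ r ∈ Ioi (0:ℝ), 7 / 8 * r ≤ φ r)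
    (hconc : ∀ r ∈ Ioi (0:ℝ), deriv (deriv φ) r ≤ 0)
    (hzero : ∀ r ∈ Ioi (0:ℝ), r ∉ (⋃ n, Icc (a n) (a n + b n)) →
      deriv (deriv φ) r = 0)
    (hbound : ∀ n, ∀ r ∈ Icc (a n) (a n + b n), -(deriv (deriv φ) r) ≤ 2 / a n) :
    ∀ r ∈ Ioi (0:ℝ),
      0 ≤ -(deriv (deriv φ) r) / φ r ∧ -(deriv (deriv φ) r) / φ r ≤ 16 / r ^ 2 := by
  intro r hr
  have hr0 : 0 < r := hr
  have hφr := hlow r hr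
  have hφpos : 0 < φ r := by linarith
  have hneg : 0 ≤ -(deriv (deriv φ) r) := neg_nonneg.mpr (hconc r hr)
  refine ⟨div_nonneg hneg hφpos.le, ?_⟩
  have hdecay : -(deriv (deriv φ) r) ≤ 4 / r := by
    by_cases hmem : r ∈ ⋃ n, Icc (a n) (a n + b n)
    · obtain ⟨n, hn⟩ := mem_iUnion.mp hmem
      refine (hbound n r hn).trans ?_
      rw [div_le_div_iff₀ (ha n) hr0]
      linarith [hn.2, hab n]
    · rw [hzero r hr hmem, neg_zero]
      positivity
  rw [le_div_iff₀ hr0] at hdecay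
  rw [div_le_div_iff₀ hφpos (by positivity)]
  calc -(deriv (deriv φ) r) * r ^ 2 = -(deriv (deriv φ) r) * r * r := by ring
    _ ≤ 4 * r := mul_le_mul_of_nonneg_right hdecay hr0.le
    _ ≤ 16 * φ r := by linarith
end

section
/- Let g : (0,∞) → ℝ be nonincreasing (antitone) and suppose g(v) converges to a finite limit L ∈ ℝ as v → ∞. For every δ > 0 define F_δ := { v ∈ (0,∞) : g is differentiable at v and |g'(v)| · v ≤ δ }. Then F_δ is Lebesgue measurable and lim_{r→∞} 𝓛¹(F_δ ∩ (r, 2r)) / r = 1. -/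
open Set Filter MeasureTheory

/-- Markov's inequality for the derivative of a function that is antitone on `[a, b]`. -/
theorem AntitoneOn.mul_volume_real_le_abs_deriv_le {g : ℝ → ℝ} {a b : ℝ} (hab : a ≤ b)
    (hg : AntitoneOn g (Icc a b)) (c : ℝ) :
    c * volume.real ({x | c ≤ |deriv g x|} ∩ Ioo a b) ≤ g a - g b := by
  have hneg : MonotoneOn (fun x => -g x) (uIcc a b) := by
    rw [uIcc_of_le hab]
    exact hg.neg
  have hint := hneg.intervalIntegrable_deriv
  have hmem := hneg.intervalIntegral_deriv_mem_uIcc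
  have hle : g b ≤ g a := hg (left_mem_Icc.2 hab) (right_mem_Icc.2 hab) hab
  rw [uIcc_of_le (by linarith), intervalIntegral.integral_of_le hab,
    integral_Ioc_eq_integral_Ioo] at hmem
  rw [intervalIntegrable_iff_integrableOn_Ioo_of_le hab] at hint
  have hderiv : ∀ x ∈ Ioo a b, deriv (fun x => -g x) x = |deriv g x| := fun x hx => by
    have hx' : derivWithin g (Icc a b) x ≤ 0 := hg.derivWithin_nonpos
    rw [derivWithin_of_mem_nhds (Icc_mem_nhds hx.1 hx.2)] at hx'
    rw [abs_of_nonpos hx', deriv.fun_neg]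
  have hint' : IntegrableOn (fun x => |deriv g x|) (Ioo a b) :=
    hint.congr_fun hderiv measurableSet_Ioo
  rw [setIntegral_congr_fun measurableSet_Ioo hderiv] at hmem
  have hmarkov := mul_meas_ge_le_integral_of_nonneg
    (ae_of_all _ fun x => abs_nonneg (deriv g x)) hint' c
  rw [measureReal_restrict_apply
    (measurableSet_le measurable_const (measurable_deriv g).abs)] at hmarkov
  linarith [hmem.2]

theorem AntitoneOn.ae_differentiableAt_of_isOpen {g : ℝ → ℝ} {s : Set ℝ} (hs : IsOpen s)
    (hg : AntitoneOn g s) : ∀ᵐ x, x ∈ s → DifferentiableAt ℝ g x := by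
  filter_upwards [hg.neg.ae_differentiableWithinAt_of_mem] with x hx hxs
  simpa using ((hx hxs).differentiableAt (hs.mem_nhds hxs)).neg

/-- Let `g : (0, ∞) → ℝ` be nonincreasing with a finite limit `L` at `∞`.
For every `δ > 0`, the set `F_δ` of points `v > 0` where `g` is differentiable and
`|g'(v)| · v ≤ δ` is Lebesgue measurable and `𝓛¹(F_δ ∩ (r, 2r)) / r → 1` as `r → ∞`. -/
theorem stmt_4 (g : ℝ → ℝ) (L : ℝ)
    (hg : AntitoneOn g (Ioi 0))
    (hlim : Tendsto g atTop (nhds L)) :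
    ∀ δ : ℝ, 0 < δ →
      NullMeasurableSet
        {v : ℝ | v ∈ Ioi (0:ℝ) ∧ DifferentiableAt ℝ g v ∧ |deriv g v| * v ≤ δ}
        volume ∧
      Tendsto
        (fun r : ℝ =>
          (volume ({v : ℝ | v ∈ Ioi (0:ℝ) ∧ DifferentiableAt ℝ g v ∧ |deriv g v| * v ≤ δ}
            ∩ Ioo r (2 * r))).toReal / r)
        atTop (nhds 1) := by
  intro δ hδ
  set F := {v : ℝ | v ∈ Ioi (0:ℝ) ∧ DifferentiableAt ℝ g v ∧ |deriv g v| * v ≤ δ}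
  have hFm : MeasurableSet F :=
    measurableSet_Ioi.inter ((measurableSet_of_differentiableAt ℝ g).inter
      (measurableSet_le ((measurable_deriv g).abs.mul measurable_id) measurable_const))
  refine ⟨hFm.nullMeasurableSet, ?_⟩
  have hlim2 : Tendsto (fun r => g (2 * r)) atTop (nhds L) :=
    hlim.comp (tendsto_id.const_mul_atTop two_pos)
  have hlower : Tendsto (fun r => 1 - 2 / δ * (g r - g (2 * r))) atTop (nhds 1) := by
    simpa using ((hlim.sub hlim2).const_mul (2 / δ)).const_sub 1
  refine tendsto_of_tendsto_of_tendsto_of_le_of_le' hlower tendsto_const_nhds ?_ ?_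
  · filter_upwards [eventually_gt_atTop 0] with r hr
    have hmarkov := (hg.mono fun x hx => hr.trans_le hx.1 :
      AntitoneOn g (Icc r (2 * r))).mul_volume_real_le_abs_deriv_le (by linarith) (δ / (2 * r))
    have hbad : volume.real (Ioo r (2 * r) \ F) ≤
        volume.real ({x | δ / (2 * r) ≤ |deriv g x|} ∩ Ioo r (2 * r)) := by
      refine ENNReal.toReal_mono
        (measure_ne_top_of_subset inter_subset_right measure_Ioo_lt_top.ne) (measure_mono_ae ?_)
      filter_upwards [hg.ae_differentiableAt_of_isOpen isOpen_Ioi] with x hx hxF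
      have hx0 : 0 < x := hr.trans hxF.1.1
      have hlt : δ < |deriv g x| * x := not_le.1 fun h => hxF.2 ⟨hx0, hx hx0, h⟩
      refine ⟨?_, hxF.1⟩
      rw [mem_ofPred_eq, div_le_iff₀ (by linarith)]
      exact hlt.le.trans (mul_le_mul_of_nonneg_left hxF.1.2.le (abs_nonneg _))
    have hsplit := measureReal_inter_add_sdiff (μ := volume) (s := Ioo r (2 * r)) hFm
      measure_Ioo_lt_top.ne
    rw [Real.volume_real_Ioo_of_le (by linarith), inter_comm] at hsplit
    change _ ≤ volume.real (F ∩ Ioo r (2 * r)) / r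
    have hscaled := (mul_le_mul_of_nonneg_left hbad (by positivity : 0 ≤ δ / (2 * r))).trans hmarkov
    rw [div_mul_eq_mul_div, div_le_iff₀ (by linarith)] at hscaled
    have hdiff : volume.real (Ioo r (2 * r) \ F) ≤ 2 / δ * (g r - g (2 * r)) * r := by
      rw [div_mul_eq_mul_div, div_mul_eq_mul_div, le_div_iff₀ hδ]
      linarith
    rw [le_div_iff₀ hr]
    linarith
  · filter_upwards [eventually_gt_atTop 0] with r hr
    have hle : volume.real (F ∩ Ioo r (2 * r)) ≤ volume.real (Ioo r (2 * r)) :=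
      measureReal_mono inter_subset_right measure_Ioo_lt_top.ne
    rw [Real.volume_real_Ioo_of_le (by linarith)] at hle
    exact (div_le_one hr).2 (hle.trans (by linarith))
end

section
/- Let μ be a finite Borel measure on ℝ. For every ε > 0 there exists a Lebesgue measurable set G ⊆ (0,∞) such that lim_{r→∞} 𝓛¹(G ∩ (r, 2r)) / r = 1, and for every V ∈ G and every h with 0 < h < V/4 one has μ( (V − h, V + h) ) ≤ ε h / V. -/
open Set Filter MeasureTheory

/-- The measure of a ball of fixed radius is a lower semicontinuous function of its centre. -/
theorem lowerSemicontinuous_measure_ball {α : Type*} [MetricSpace α] [ProperSpace α]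
    [MeasurableSpace α] (μ : Measure α) [μ.Regular] (h : ℝ) :
    LowerSemicontinuous fun x => μ (Metric.ball x h) := by
  intro x c hc
  obtain ⟨K, hKx, hK, hcK⟩ := Metric.isOpen_ball.exists_lt_isCompact hc
  obtain ⟨r, hr, hKr⟩ := exists_lt_subset_ball hK.isClosed hKx
  filter_upwards [Metric.ball_mem_nhds x (sub_pos.2 hr)] with y hy
  refine hcK.trans_le (measure_mono (hKr.trans (Metric.ball_subset_ball' ?_)))
  rw [dist_comm]
  linarith [Metric.mem_ball.1 hy]

/-- A Hardy–Littlewood type covering estimate: if every point of `s` is the centre of a ball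
inside `t`, of bounded radius `h`, whose `μ`-measure is at least `c * h`, then the Lebesgue measure
of `s` is at most `10 / c * μ t`. -/
theorem volume_le_of_forall_exists_le_measure_ball (μ : Measure ℝ) {s t : Set ℝ} {c R : ℝ}
    (hc : 0 < c)
    (hs : ∀ x ∈ s, ∃ h, 0 < h ∧ h ≤ R ∧ Metric.ball x h ⊆ t ∧
      ENNReal.ofReal (c * h) ≤ μ (Metric.ball x h)) :
    volume s ≤ ENNReal.ofReal (10 / c) * μ t := by
  choose! h hpos hR hsub hle using hs
  obtain ⟨u, hus, hdisj, hcov⟩ :=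
    Vitali.exists_disjoint_subfamily_covering_enlargement_ball s id h R hR 5 (by norm_num)
  have hu : u.Countable := hdisj.countable_of_isOpen (fun _ _ => Metric.isOpen_ball)
    fun x hx => Metric.nonempty_ball.2 (hpos x (hus hx))
  have hsu : s ⊆ ⋃ x ∈ u, Metric.ball x (5 * h x) := by
    intro x hx
    obtain ⟨y, hy, hxy⟩ := hcov x hx
    exact mem_biUnion hy (hxy (Metric.mem_ball_self (hpos x hx)))
  calc volume s ≤ volume (⋃ x ∈ u, Metric.ball x (5 * h x)) := measure_mono hsu
    _ ≤ ∑' x : u, volume (Metric.ball (x : ℝ) (5 * h x)) := measure_biUnion_le _ hu _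
    _ ≤ ∑' x : u, ENNReal.ofReal (10 / c) * μ (Metric.ball (x : ℝ) (h x)) := by
        refine ENNReal.tsum_le_tsum fun x => ?_
        calc volume (Metric.ball (x : ℝ) (5 * h x))
            = ENNReal.ofReal (10 / c) * ENNReal.ofReal (c * h x) := by
              rw [Real.volume_ball, ← ENNReal.ofReal_mul (by positivity)]
              congr 1
              field_simp
              ring
          _ ≤ _ := by gcongr; exact hle x (hus x.2)
    _ = ENNReal.ofReal (10 / c) * μ (⋃ x ∈ u, Metric.ball x (h x)) := by
        rw [ENNReal.tsum_mul_left]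
        congr 1
        exact (measure_biUnion hu hdisj fun _ _ => Metric.isOpen_ball.measurableSet).symm
    _ ≤ ENNReal.ofReal (10 / c) * μ t := by
        gcongr
        exact iUnion₂_subset fun x hx => hsub x (hus hx)

theorem tendsto_measureReal_Ioi_atTop (μ : Measure ℝ) [IsFiniteMeasure μ] :
    Tendsto (fun r => μ.real (Ioi r)) atTop (nhds 0) := by
  have h := tendsto_measure_iInter_atTop (μ := μ) (s := fun r : ℝ => Ioi r)
    (fun _ => measurableSet_Ioi.nullMeasurableSet) (fun _ _ h => Ioi_subset_Ioi h)
    ⟨0, measure_ne_top _ _⟩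
  have he : ⋂ r : ℝ, Ioi r = ∅ :=
    eq_empty_of_forall_notMem fun x hx => lt_irrefl x (mem_iInter.1 hx x)
  rw [he, measure_empty] at h
  exact (ENNReal.tendsto_toReal ENNReal.zero_ne_top).comp h

/-- The volumes `V` at which `μ` has mass more than `ε h / V` in a ball of some radius
`h < V / 4`. -/
def badVolumes (μ : Measure ℝ) (ε : ℝ) : Set ℝ :=
  {V | ∃ h, 0 < h ∧ h < V / 4 ∧ ENNReal.ofReal (ε * h / V) < μ (Metric.ball V h)}

theorem isOpen_badVolumes (μ : Measure ℝ) [IsFiniteMeasure μ] (ε : ℝ) :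
    IsOpen (badVolumes μ ε) := by
  rw [isOpen_iff_mem_nhds]
  rintro V ⟨h, hpos, hV, hlt⟩
  obtain ⟨c, hc, hcμ⟩ := exists_between hlt
  have hV0 : V ≠ 0 := by linarith
  have hcont : ContinuousAt (fun W : ℝ => ENNReal.ofReal (ε * h / W)) V :=
    ENNReal.continuous_ofReal.continuousAt.comp (continuousAt_const.div continuousAt_id hV0)
  have hV' : ∀ᶠ W in nhds V, h < W / 4 :=
    (continuousAt_id.div_const 4).eventually (lt_mem_nhds hV)
  filter_upwards [hV', hcont.eventually (gt_mem_nhds hc),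
    lowerSemicontinuous_measure_ball μ h V c hcμ] with W h₁ h₂ h₃
  exact ⟨h, hpos, h₁, h₂.trans h₃⟩

theorem measureReal_badVolumes_inter_Ioo_le (μ : Measure ℝ) [IsFiniteMeasure μ] {ε r : ℝ}
    (hε : 0 < ε) (hr : 0 < r) :
    volume.real (badVolumes μ ε ∩ Ioo r (2 * r)) ≤ 20 / ε * μ.real (Ioi (r / 2)) * r := by
  have key : volume (badVolumes μ ε ∩ Ioo r (2 * r)) ≤
      ENNReal.ofReal (10 / (ε / (2 * r))) * μ (Ioi (r / 2)) := by
    refine volume_le_of_forall_exists_le_measure_ball μ (R := r / 2) (by positivity) ?_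
    rintro V ⟨⟨h, hpos, hV, hlt⟩, hrV, hVr⟩
    refine ⟨h, hpos, by linarith, fun x hx => ?_, le_trans ?_ hlt.le⟩
    · rw [Real.ball_eq_Ioo] at hx
      rw [mem_Ioi]
      linarith [hx.1]
    · rw [div_mul_eq_mul_div]
      have : 0 < V := hr.trans hrV
      gcongr
  refine (ENNReal.toReal_mono (ENNReal.mul_ne_top ENNReal.ofReal_ne_top (measure_ne_top _ _))
    key).trans_eq ?_
  rw [ENNReal.toReal_mul, ENNReal.toReal_ofReal (by positivity), Measure.real]
  field_simp
  ring

/-- For every finite Borel measure `μ` on `ℝ` and every `ε > 0`, there is a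
Lebesgue measurable set `G ⊆ (0, ∞)` with `𝓛¹(G ∩ (r, 2r)) / r → 1` as `r → ∞`, such that
for every `V ∈ G` and every `0 < h < V/4` one has `μ((V - h, V + h)) ≤ ε h / V`. -/
theorem stmt_7 (μ : Measure ℝ) [IsFiniteMeasure μ] :
    ∀ ε : ℝ, 0 < ε →
      ∃ G : Set ℝ, G ⊆ Ioi 0 ∧ NullMeasurableSet G volume ∧
        Tendsto (fun r : ℝ => (volume (G ∩ Ioo r (2 * r))).toReal / r) atTop (nhds 1) ∧
        ∀ V ∈ G, ∀ h : ℝ, 0 < h → h < V / 4 →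
          μ (Ioo (V - h) (V + h)) ≤ ENNReal.ofReal (ε * h / V) := by
  intro ε hε
  have hB : MeasurableSet (badVolumes μ ε) := (isOpen_badVolumes μ ε).measurableSet
  refine ⟨Ioi 0 \ badVolumes μ ε, sdiff_subset, (measurableSet_Ioi.diff hB).nullMeasurableSet,
    ?_, ?_⟩
  · have hlim : Tendsto (fun r : ℝ => 1 - 20 / ε * μ.real (Ioi (r / 2))) atTop (nhds 1) := by
      have := ((tendsto_measureReal_Ioi_atTop μ).comp
        (tendsto_id.atTop_div_const (r := (2 : ℝ)) two_pos)).const_mul (20 / ε)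
      simpa using this.const_sub 1
    have hsplit : ∀ r : ℝ, 0 < r → volume.real ((Ioi 0 \ badVolumes μ ε) ∩ Ioo r (2 * r)) =
        r - volume.real (badVolumes μ ε ∩ Ioo r (2 * r)) := by
      intro r hr
      have he : (Ioi 0 \ badVolumes μ ε) ∩ Ioo r (2 * r) = Ioo r (2 * r) \ badVolumes μ ε := by
        ext x
        simp only [mem_inter_iff, Set.mem_sdiff, mem_Ioi, mem_Ioo]
        exact ⟨fun h => ⟨h.2, h.1.2⟩, fun h => ⟨⟨hr.trans h.1.1, h.2⟩, h.1⟩⟩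
      have hadd := measureReal_inter_add_sdiff (μ := volume) (s := Ioo r (2 * r)) hB
        measure_Ioo_lt_top.ne
      rw [Real.volume_real_Ioo_of_le (by linarith), inter_comm] at hadd
      rw [he]
      linarith
    refine tendsto_of_tendsto_of_tendsto_of_le_of_le' hlim tendsto_const_nhds ?_ ?_
    · filter_upwards [eventually_gt_atTop 0] with r hr
      rw [← Measure.real, hsplit r hr, le_div_iff₀ hr]
      linarith [measureReal_badVolumes_inter_Ioo_le μ hε hr]
    · filter_upwards [eventually_gt_atTop 0] with r hr
      rw [← Measure.real, hsplit r hr, div_le_one hr]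
      linarith [measureReal_nonneg (μ := volume) (s := badVolumes μ ε ∩ Ioo r (2 * r))]
  · intro V hV h hpos hlt
    rw [← Real.ball_eq_Ioo]
    by_contra! hcon
    exact hV.2 ⟨h, hpos, hlt, hcon⟩
end

section
/- Let n ≥ 3 be an integer and set θ := n/(n−2) and q_k := 2 θ^k for k ∈ ℕ. Let (X, 𝔉, μ) be a measure space and let w : X → [0,∞) be measurable with ‖w‖_{L²(μ)} < ∞. Suppose there is a constant C ≥ 1 such that for every k ∈ ℕ, ‖w‖_{L^{θ q_k}(μ)} ≤ ( C q_k / √(q_k − 1) + C )^{2/q_k} ‖w‖_{L^{q_k}(μ)}. Then the infinite product C' := ∏_{k=0}^∞ ( C q_k / √(q_k − 1) + C )^{2/q_k} is finite and ‖w‖_{L^∞(μ)} ≤ C' ‖w‖_{L²(μ)}. -/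
open Set Filter MeasureTheory

/-- A uniform bound on `Lᵖ` norms along exponents tending to infinity bounds the `L^∞` norm. -/
theorem eLpNorm_top_le_of_tendsto_atTop {Ω E ι : Type*} [MeasurableSpace Ω]
    [NormedAddCommGroup E] {μ : Measure Ω} {f : Ω → E} (hf : AEStronglyMeasurable f μ)
    {l : Filter ι} [l.NeBot] {p : ι → ℝ} (hp : Tendsto p l atTop) {M : ENNReal}
    (hM : ∀ᶠ i in l, eLpNorm f (ENNReal.ofReal (p i)) μ ≤ M) :
    eLpNorm f ⊤ μ ≤ M := by
  by_contra! h
  obtain ⟨a, hMa, ha⟩ := exists_between h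
  have ha0 : a ≠ 0 := (bot_le.trans_lt hMa).ne'
  have hatop : a ≠ ⊤ := (ha.trans_le le_top).ne
  have hlt : M / a < 1 := ENNReal.div_lt_of_lt_mul (by simpa using hMa)
  have hlim : Tendsto (fun i => (M / a) ^ p i) l (nhds 0) :=
    (ENNReal.tendsto_rpow_atTop_of_base_lt_one hlt).comp hp
  have hle : ∀ᶠ i in l, μ {x | a ≤ ‖f x‖ₑ} ≤ (M / a) ^ p i := by
    filter_upwards [hM, hp.eventually_gt_atTop 0] with i hi hpos
    have hcheb := mul_meas_ge_le_pow_eLpNorm' μ (p := ENNReal.ofReal (p i))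
      (by simpa using hpos) ENNReal.ofReal_ne_top hf a
    rw [ENNReal.toReal_ofReal hpos.le] at hcheb
    rw [ENNReal.div_rpow_of_nonneg _ _ hpos.le,
      ENNReal.le_div_iff_mul_le (Or.inl (by simp [ENNReal.rpow_eq_zero_iff, ha0, hatop]))
        (Or.inl (ENNReal.rpow_ne_top_of_nonneg hpos.le hatop)), mul_comm]
    exact hcheb.trans (ENNReal.rpow_le_rpow hi hpos.le)
  have hzero : μ {x | a ≤ ‖f x‖ₑ} = 0 := le_antisymm (ge_of_tendsto hlim hle) bot_le
  refine ha.not_ge ?_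
  rw [eLpNorm_exponent_top]
  refine essSup_le_of_ae_le a ?_
  have hae : ∀ᵐ x ∂μ, ¬ a ≤ ‖f x‖ₑ := by simpa [ae_iff] using hzero
  filter_upwards [hae] with x hx using (not_le.1 hx).le

/-- A linear upper bound for the base of a Moser iteration factor. -/
theorem mul_div_sqrt_add_le {C t : ℝ} (hC : 0 ≤ C) (ht : 2 ≤ t) :
    C * t / Real.sqrt (t - 1) + C ≤ 2 * C * t := by
  have hsqrt : 1 ≤ Real.sqrt (t - 1) := Real.one_le_sqrt.2 (by linarith)
  have hdiv : C * t / Real.sqrt (t - 1) ≤ C * t := div_le_self (by positivity) hsqrt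
  have hCt : C * 1 ≤ C * t := mul_le_mul_of_nonneg_left (by linarith) hC
  linarith

/-- Moser iteration factors are at least one. -/
theorem one_le_moser_factor {C t : ℝ} (hC : 1 ≤ C) (ht : 0 ≤ t) :
    1 ≤ (C * t / Real.sqrt (t - 1) + C) ^ (2 / t) := by
  refine Real.one_le_rpow ?_ (by positivity)
  have : 0 ≤ C * t / Real.sqrt (t - 1) := by positivity
  linarith

/-- The logarithm of a Moser iteration factor decays like `log t / t`. -/
theorem log_moser_factor_le {C t : ℝ} (hC : 1 ≤ C) (ht : 2 ≤ t) :
    Real.log ((C * t / Real.sqrt (t - 1) + C) ^ (2 / t)) ≤ 2 / t * Real.log (2 * C * t) := by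
  have hpos : 0 < C * t / Real.sqrt (t - 1) + C := by positivity
  rw [Real.log_rpow hpos]
  exact mul_le_mul_of_nonneg_left
    (Real.log_le_log hpos (mul_div_sqrt_add_le (by linarith) ht)) (by positivity)

/-- The Moser iteration factors along a geometric sequence have summable logarithms. -/
theorem summable_log_moser_factor {θ C : ℝ} (hθ : 1 < θ) (hC : 1 ≤ C) :
    Summable fun k : ℕ => Real.log ((C * (2 * θ ^ k) / Real.sqrt (2 * θ ^ k - 1) + C) ^
      (2 / (2 * θ ^ k))) := by
  have hθ0 : 0 < θ := by linarith
  have hr0 : 0 ≤ θ⁻¹ := inv_nonneg.2 hθ0.le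
  have hr1 : θ⁻¹ < 1 := inv_lt_one_of_one_lt₀ hθ
  have hgeom : Summable fun k : ℕ => θ⁻¹ ^ k := summable_geometric_of_lt_one hr0 hr1
  have hlin : Summable fun k : ℕ => (k : ℝ) ^ 1 * θ⁻¹ ^ k :=
    summable_pow_mul_geometric_of_norm_lt_one 1 (by rwa [Real.norm_of_nonneg hr0])
  have hmaj : Summable fun k : ℕ =>
      Real.log (4 * C) * θ⁻¹ ^ k + Real.log θ * ((k : ℝ) ^ 1 * θ⁻¹ ^ k) :=
    (hgeom.mul_left (Real.log (4 * C))).add (hlin.mul_left (Real.log θ))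
  have heq (k : ℕ) : 2 / (2 * θ ^ k) * Real.log (2 * C * (2 * θ ^ k)) =
      Real.log (4 * C) * θ⁻¹ ^ k + Real.log θ * ((k : ℝ) ^ 1 * θ⁻¹ ^ k) := by
    have hk : θ ^ k ≠ 0 := (pow_pos hθ0 k).ne'
    rw [show 2 * C * (2 * θ ^ k) = 4 * C * θ ^ k by ring,
      Real.log_mul (by positivity) hk, Real.log_pow, inv_pow, pow_one]
    field_simp
  refine hmaj.of_nonneg_of_le (fun k => ?_) (fun k => ?_)
  · exact Real.log_nonneg (one_le_moser_factor hC (by positivity))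
  · rw [← heq]
    exact log_moser_factor_le hC (by linarith [one_le_pow₀ hθ.le (n := k)])

/-- Iterating a multiplicative recursive bound in `ℝ≥0∞`, with factors at least one whose infinite
product converges, gives a uniform bound. -/
theorem le_ofReal_tprod_mul_of_le_succ {F : ℕ → ℝ} (hF : ∀ k, 1 ≤ F k) (hmul : Multipliable F)
    {a : ℕ → ENNReal} (ha : ∀ k, a (k + 1) ≤ ENNReal.ofReal (F k) * a k) (k : ℕ) :
    a k ≤ ENNReal.ofReal (∏' j, F j) * a 0 := by
  have hpos (k : ℕ) : 0 < F k := by linarith [hF k]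
  have hmono : Monotone fun k => ∏ j ∈ Finset.range k, F j := by
    refine monotone_nat_of_le_succ fun k => ?_
    rw [Finset.prod_range_succ]
    exact le_mul_of_one_le_right (Finset.prod_nonneg fun j _ => (hpos j).le) (hF k)
  have hpartial : a k ≤ ENNReal.ofReal (∏ j ∈ Finset.range k, F j) * a 0 := by
    induction k with
    | zero => simp
    | succ k ih =>
      rw [Finset.prod_range_succ, mul_comm _ (F k), ENNReal.ofReal_mul (hpos k).le, mul_assoc]
      exact (ha k).trans (by gcongr)
  refine hpartial.trans ?_
  gcongr
  exact hmono.ge_of_tendsto hmul.hasProd.tendsto_prod_nat k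

/-- **abstract Moser iteration.** Let `n ≥ 3`, `θ := n/(n-2)`, `q_k := 2 θ^k`.
Let `w ≥ 0` be measurable on a measure space with finite `L²` norm, and suppose that for some
`C ≥ 1` and all `k`, `‖w‖_{L^{θ q_k}} ≤ (C q_k / √(q_k - 1) + C)^{2/q_k} ‖w‖_{L^{q_k}}`.
Then the infinite product `C' := ∏_k (C q_k / √(q_k - 1) + C)^{2/q_k}` converges and
`‖w‖_{L^∞} ≤ C' ‖w‖_{L²}`. -/
theorem stmt_8 (n : ℕ) (hn : 3 ≤ n)
    (θ : ℝ) (hθ : θ = (n : ℝ) / ((n : ℝ) - 2))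
    (q : ℕ → ℝ) (hq : ∀ k, q k = 2 * θ ^ k)
    {Ω : Type*} [MeasurableSpace Ω] (μ : Measure Ω)
    (w : Ω → ℝ) (hw : Measurable w) (hwnonneg : ∀ x, 0 ≤ w x)
    (hw2 : eLpNorm w 2 μ < ⊤)
    (C : ℝ) (hC : 1 ≤ C)
    (F : ℕ → ℝ)
    (hF : ∀ k, F k = (C * q k / Real.sqrt (q k - 1) + C) ^ (2 / q k))
    (hiter : ∀ k : ℕ,
      eLpNorm w (ENNReal.ofReal (θ * q k)) μ ≤
        ENNReal.ofReal (F k) * eLpNorm w (ENNReal.ofReal (q k)) μ) :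
    Multipliable F ∧
      eLpNorm w ⊤ μ ≤ ENNReal.ofReal (∏' k, F k) * eLpNorm w 2 μ := by
  have hn' : (3 : ℝ) ≤ n := by exact_mod_cast hn
  have hθ1 : 1 < θ := by
    rw [hθ, one_lt_div (by linarith)]
    linarith
  have hq0 (k : ℕ) : 0 ≤ q k := by
    rw [hq]
    have : 0 < θ := by linarith
    positivity
  have hF1 (k : ℕ) : 1 ≤ F k := by
    rw [hF]
    exact one_le_moser_factor hC (hq0 k)
  have hmul : Multipliable F := by
    refine Real.multipliable_of_summable_log (fun k => by linarith [hF1 k]) ?_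
    simpa only [hF, hq] using summable_log_moser_factor hθ1 hC
  have hqlim : Tendsto q atTop atTop := by
    rw [funext hq]
    exact (tendsto_pow_atTop_atTop_of_one_lt hθ1).const_mul_atTop two_pos
  have hbound := le_ofReal_tprod_mul_of_le_succ hF1 hmul
    (a := fun k => eLpNorm w (ENNReal.ofReal (q k)) μ) fun k => by
      have hsucc : q (k + 1) = θ * q k := by rw [hq, hq]; ring
      simpa only [hsucc] using hiter k
  have h0 : ENNReal.ofReal (q 0) = 2 := by simp [hq]
  simp only [h0] at hbound
  exact ⟨hmul, eLpNorm_top_le_of_tendsto_atTop hw.aestronglyMeasurable hqlim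
    (Eventually.of_forall hbound)⟩
end
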